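/- arXiv:2402.07735 — 3 statements merged into one kernel-verified Lean document; each statement's English description precedes it below -/
import Mathlib

section
/- Let d ≥ 1 and let S be a real symmetric positive definite d×d matrix. Then the largest eigenvalue of the custom softmax σ̃(S) is 1; that is, 1 is an eigenvalue of σ̃(S) and every eigenvalue of σ̃(S) is at most 1. -/
open Matrix BigOperators

/-- Entrywise exponential of a matrix. -/
noncomputable def entExp {d : ℕ} (S : Matrix (Fin d) (Fin d) ℝ) : Matrix (Fin d) (Fin d) ℝ :=
  Matrix.of fun i j => Real.exp (S i j)

/-- Row sums of the entrywise exponential. -/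
noncomputable def rowSum {d : ℕ} (S : Matrix (Fin d) (Fin d) ℝ) (i : Fin d) : ℝ :=
  ∑ j, Real.exp (S i j)

/-- The custom softmax σ̃(S), with entries exp(S i j) / √(r i * r j). -/
noncomputable def softmaxTilde {d : ℕ} (S : Matrix (Fin d) (Fin d) ℝ) : Matrix (Fin d) (Fin d) ℝ :=
  Matrix.of fun i j => Real.exp (S i j) / Real.sqrt (rowSum S i * rowSum S j)

theorem rowSum_pos {d : ℕ} (S : Matrix (Fin d) (Fin d) ℝ) (i : Fin d) : 0 < rowSum S i :=
  Finset.sum_pos (fun _ _ => Real.exp_pos _) ⟨i, Finset.mem_univ i⟩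

theorem softmaxTilde_mulVec_sqrt_rowSum_mul {d : ℕ} (S : Matrix (Fin d) (Fin d) ℝ)
    (w : Fin d → ℝ) (i : Fin d) :
    (softmaxTilde S).mulVec (fun j => √(rowSum S j) * w j) i =
      (∑ j, Real.exp (S i j) * w j) / √(rowSum S i) := by
  simp only [softmaxTilde, mulVec, dotProduct, of_apply, Finset.sum_div]
  refine Finset.sum_congr rfl fun j _ => ?_
  have hi := Real.sqrt_pos.2 (rowSum_pos S i)
  have hj := Real.sqrt_pos.2 (rowSum_pos S j)
  rw [Real.sqrt_mul (rowSum_pos S i).le]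
  field_simp

/-- Conjugating by `√r` turns an eigenvector of the custom softmax into an eigenvector of the
row-stochastic softmax. -/
theorem sum_exp_mul_eq_of_softmaxTilde_mulVec_eq {d : ℕ} {S : Matrix (Fin d) (Fin d) ℝ} {μ : ℝ}
    {w : Fin d → ℝ}
    (h : (softmaxTilde S).mulVec (fun j => √(rowSum S j) * w j) =
      μ • fun j => √(rowSum S j) * w j) (i : Fin d) :
    ∑ j, Real.exp (S i j) * w j = rowSum S i * (μ * w i) := by
  have hi := Real.sqrt_pos.2 (rowSum_pos S i)
  have key := congrFun h i
  rw [softmaxTilde_mulVec_sqrt_rowSum_mul, div_eq_iff hi.ne', Pi.smul_apply, smul_eq_mul] at key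
  rw [key]
  linear_combination (μ * w i) * Real.mul_self_sqrt (rowSum_pos S i).le

theorem softmaxTilde_mulVec_sqrt_rowSum {d : ℕ} (S : Matrix (Fin d) (Fin d) ℝ) :
    (softmaxTilde S).mulVec (fun j => √(rowSum S j)) = fun j => √(rowSum S j) := by
  funext i
  have h := softmaxTilde_mulVec_sqrt_rowSum_mul S (fun _ => 1) i
  simp only [mul_one] at h
  rw [h]
  exact Real.div_sqrt

theorem le_one_of_softmaxTilde_mulVec_eq {d : ℕ} {S : Matrix (Fin d) (Fin d) ℝ} {μ : ℝ}
    {v : Fin d → ℝ} (hv : v ≠ 0) (h : (softmaxTilde S).mulVec v = μ • v) : μ ≤ 1 := by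
  obtain ⟨w, rfl⟩ : ∃ w : Fin d → ℝ, v = fun j => √(rowSum S j) * w j :=
    ⟨fun j => v j / √(rowSum S j), funext fun j =>
      (mul_div_cancel₀ (v j) (Real.sqrt_pos.2 (rowSum_pos S j)).ne').symm⟩
  obtain ⟨k, hk⟩ : ∃ k, w k ≠ 0 := by
    by_contra! hw
    exact hv (funext fun j => by simp [hw j])
  have : Nonempty (Fin d) := ⟨k⟩
  obtain ⟨i, hi⟩ := Finite.exists_max fun j => |w j|
  have hwi : 0 < |w i| := (abs_pos.2 hk).trans_le (hi k)
  have hbound : rowSum S i * (|μ| * |w i|) ≤ rowSum S i * |w i| :=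
    calc rowSum S i * (|μ| * |w i|) = |∑ j, Real.exp (S i j) * w j| := by
          rw [sum_exp_mul_eq_of_softmaxTilde_mulVec_eq h, abs_mul, abs_mul,
            abs_of_pos (rowSum_pos S i)]
      _ ≤ ∑ j, |Real.exp (S i j) * w j| := Finset.abs_sum_le_sum_abs _ _
      _ ≤ ∑ j, Real.exp (S i j) * |w i| := by
          refine Finset.sum_le_sum fun j _ => ?_
          rw [abs_mul, Real.abs_exp]
          exact mul_le_mul_of_nonneg_left (hi j) (Real.exp_pos _).le
      _ = rowSum S i * |w i| := by rw [rowSum, Finset.sum_mul]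
  have hμ : |μ| * |w i| ≤ 1 * |w i| := by
    simpa using le_of_mul_le_mul_left hbound (rowSum_pos S i)
  exact (le_abs_self μ).trans (le_of_mul_le_mul_right hμ hwi)

/-- For a symmetric positive definite matrix `S` (with `d ≥ 1`), the largest eigenvalue of
the custom softmax `σ̃(S)` is `1`: `1` is an eigenvalue, and every eigenvalue is at most `1`. -/
theorem largest_eigenvalue_softmaxTilde_eq_one
    (d : ℕ) (hd : 1 ≤ d) (S : Matrix (Fin d) (Fin d) ℝ) (hS : S.PosDef) :
    (∃ v : Fin d → ℝ, v ≠ 0 ∧ (softmaxTilde S).mulVec v = (1 : ℝ) • v) ∧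
    (∀ (μ : ℝ) (v : Fin d → ℝ), v ≠ 0 → (softmaxTilde S).mulVec v = μ • v → μ ≤ 1) := by
  refine ⟨⟨fun j => √(rowSum S j), fun h => ?_, ?_⟩,
    fun μ v hv h => le_one_of_softmaxTilde_mulVec_eq hv h⟩
  · exact (Real.sqrt_pos.2 (rowSum_pos S ⟨0, hd⟩)).ne' (congrFun h ⟨0, hd⟩)
  · rw [one_smul, softmaxTilde_mulVec_sqrt_rowSum]
end

section
/- If S is a real symmetric positive definite d×d matrix, then the entrywise exponential exp[S], with (exp[S])_{ij} = exp(S_{ij}), is also symmetric positive definite. -/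
open Matrix

/-- Entrywise natural powers of a real positive semidefinite matrix are positive semidefinite. -/
theorem Matrix.PosSemidef.map_pow {n : Type*} [Fintype n] {A : Matrix n n ℝ}
    (hA : A.PosSemidef) (k : ℕ) : (A.map (· ^ k)).PosSemidef := by
  induction k with
  | zero =>
    convert posSemidef_vecMulVec_self_star (1 : n → ℝ) using 1
    ext i j
    simp [vecMulVec_apply]
  | succ k ih =>
    have hmul : A.map (· ^ (k + 1)) = A.map (· ^ k) ⊙ A := by
      ext i j
      simp [pow_succ]
    rw [hmul]
    exact ih.hadamard hA

/-- The quadratic form of `exp[S]` is the exponential series of those of the entrywise powers. -/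
theorem hasSum_dotProduct_entExp_mulVec {d : ℕ} (S : Matrix (Fin d) (Fin d) ℝ) (x : Fin d → ℝ) :
    HasSum (fun k : ℕ => (k.factorial : ℝ)⁻¹ * (star x ⬝ᵥ (S.map (· ^ k) *ᵥ x)))
      (star x ⬝ᵥ (entExp S *ᵥ x)) := by
  have hexp (t : ℝ) : HasSum (fun k : ℕ => (k.factorial : ℝ)⁻¹ * t ^ k) (Real.exp t) := by
    simpa [Real.exp_eq_exp_ℝ] using NormedSpace.exp_series_hasSum_exp' (𝕂 := ℝ) t
  simp only [dotProduct, mulVec, Finset.mul_sum, map_apply, entExp, of_apply]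
  refine hasSum_sum fun i _ => hasSum_sum fun j _ => ?_
  simpa only [mul_left_comm, mul_assoc] using
    ((hexp (S i j)).mul_right (x j)).mul_left (star x i)

/-- If `S` is real symmetric positive definite, then the entrywise exponential `exp[S]`
is also symmetric positive definite. -/
theorem entExp_posDef (d : ℕ) (S : Matrix (Fin d) (Fin d) ℝ) (hS : S.PosDef) :
    (entExp S).PosDef := by
  refine .of_dotProduct_mulVec_pos ?_ fun x hx => ?_
  · ext i j
    simpa [entExp] using hS.isHermitian.apply i j
  · refine lt_of_lt_of_le ?_
      (le_hasSum (hasSum_dotProduct_entExp_mulVec S x) 1 fun k _ => ?_)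
    · simpa using hS.dotProduct_mulVec_pos hx
    · exact mul_nonneg (by positivity) ((hS.posSemidef.map_pow k).dotProduct_mulVec_nonneg x)
end

section
/- If S is a real symmetric positive definite d×d matrix, then σ̃(S) is symmetric positive definite, and consequently every eigenvalue λ of σ̃(S) satisfies 0 < λ ≤ 1. -/
open Matrix BigOperators

namespace Matrix

variable {ι : Type*} [Fintype ι]

/-- Entrywise powers of a positive semidefinite matrix are positive semidefinite. -/
theorem PosSemidef.map_pow_s3 {A : Matrix ι ι ℝ} (hA : A.PosSemidef) (n : ℕ) :
    (A.map (· ^ n)).PosSemidef := by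
  induction n with
  | zero =>
    convert posSemidef_vecMulVec_self_star (1 : ι → ℝ) using 1
    ext i j
    simp [vecMulVec_apply]
  | succ n ih =>
    have hmap : A.map (· ^ (n + 1)) = A.map (· ^ n) ⊙ A := by
      ext i j
      simp [pow_succ]
    rw [hmap]
    exact ih.hadamard hA

/-- The quadratic form of the entrywise exponential, expanded into entrywise powers. -/
theorem hasSum_dotProduct_map_exp_mulVec (A : Matrix ι ι ℝ) (x : ι → ℝ) :
    HasSum (fun n : ℕ => (n.factorial : ℝ)⁻¹ * (x ⬝ᵥ (A.map (· ^ n) *ᵥ x)))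
      (x ⬝ᵥ (A.map Real.exp *ᵥ x)) := by
  have hentry (i j : ι) :
      HasSum (fun n : ℕ => x i * ((A i j ^ n / n.factorial) * x j))
        (x i * (Real.exp (A i j) * x j)) := by
    rw [Real.exp_eq_exp_ℝ]
    exact ((NormedSpace.expSeries_div_hasSum_exp (A i j)).mul_right _).mul_left _
  convert hasSum_sum fun i (_ : i ∈ Finset.univ) =>
    hasSum_sum fun j (_ : j ∈ Finset.univ) => hentry i j using 1
  · ext n
    simp only [dotProduct, mulVec, map_apply, Finset.mul_sum]
    refine Finset.sum_congr rfl fun i _ => Finset.sum_congr rfl fun j _ => ?_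
    ring
  · simp only [dotProduct, mulVec, map_apply, Finset.mul_sum]

/-- The entrywise exponential of a positive definite matrix is positive definite. -/
theorem PosDef.map_exp {A : Matrix ι ι ℝ} (hA : A.PosDef) : (A.map Real.exp).PosDef := by
  refine .of_dotProduct_mulVec_pos (hA.isHermitian.map _ fun _ => rfl) fun x hx => ?_
  have hlinear : 0 < x ⬝ᵥ (A *ᵥ x) := by simpa using hA.dotProduct_mulVec_pos hx
  have hle := le_hasSum (hasSum_dotProduct_map_exp_mulVec A x) 1 fun n _ =>
    mul_nonneg (by positivity)
      (by simpa using (hA.posSemidef.map_pow_s3 n).dotProduct_mulVec_nonneg x)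
  have hmap : A.map (· ^ 1) = A := by ext; simp
  rw [hmap] at hle
  simpa using hlinear.trans_le (by simpa using hle)

/-- A symmetric matrix with nonnegative entries is dominated, as a quadratic form, by the diagonal
matrix of its row sums. -/
theorem IsSymm.sum_mul_mul_le_sum_rowSum {A : Matrix ι ι ℝ} (hA : A.IsSymm)
    (hnonneg : ∀ i j, 0 ≤ A i j) (w : ι → ℝ) :
    ∑ i, ∑ j, A i j * (w i * w j) ≤ ∑ i, (∑ j, A i j) * w i ^ 2 := by
  have hswap : ∑ i, ∑ j, A i j * w j ^ 2 = ∑ i, ∑ j, A i j * w i ^ 2 := by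
    rw [Finset.sum_comm]
    simp only [hA.apply]
  have hle : ∑ i, ∑ j, 2 * (A i j * (w i * w j)) ≤
      ∑ i, ∑ j, (A i j * w i ^ 2 + A i j * w j ^ 2) :=
    Finset.sum_le_sum fun i _ => Finset.sum_le_sum fun j _ => by
      nlinarith [mul_nonneg (hnonneg i j) (sq_nonneg (w i - w j))]
  simp only [Finset.sum_add_distrib, hswap, ← Finset.mul_sum] at hle
  simp only [Finset.sum_mul]
  linarith

end Matrix

theorem softmaxTilde_eq_diagonal_mul_mul {d : ℕ} (S : Matrix (Fin d) (Fin d) ℝ) :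
    softmaxTilde S = diagonal (fun i => (√(rowSum S i))⁻¹) * S.map Real.exp *
      (diagonal fun i => (√(rowSum S i))⁻¹)ᴴ := by
  ext i j
  simp only [softmaxTilde, of_apply, diagonal_conjTranspose, mul_diagonal, diagonal_mul, map_apply,
    star_trivial, Real.sqrt_mul (rowSum_pos S i).le, div_eq_mul_inv, mul_inv]
  ring

theorem softmaxTilde_posDef {d : ℕ} {S : Matrix (Fin d) (Fin d) ℝ} (hS : S.PosDef) :
    (softmaxTilde S).PosDef := by
  rw [softmaxTilde_eq_diagonal_mul_mul]
  refine hS.map_exp.mul_mul_conjTranspose_same (vecMul_injective_of_isUnit ?_)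
  rw [isUnit_diagonal, Pi.isUnit_iff]
  exact fun i => (inv_ne_zero (Real.sqrt_pos.2 (rowSum_pos S i)).ne').isUnit

theorem dotProduct_softmaxTilde_mulVec_le {d : ℕ} {S : Matrix (Fin d) (Fin d) ℝ}
    (hS : S.IsSymm) (v : Fin d → ℝ) : v ⬝ᵥ (softmaxTilde S *ᵥ v) ≤ v ⬝ᵥ v := by
  convert (hS.map Real.exp).sum_mul_mul_le_sum_rowSum (fun _ _ => (Real.exp_pos _).le)
    (fun i => v i / √(rowSum S i)) using 1
  · simp only [dotProduct, mulVec, softmaxTilde, of_apply, map_apply, Finset.mul_sum]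
    refine Finset.sum_congr rfl fun i _ => Finset.sum_congr rfl fun j _ => ?_
    rw [Real.sqrt_mul (rowSum_pos S i).le]
    ring
  · refine Finset.sum_congr rfl fun i _ => ?_
    change v i * v i = rowSum S i * _
    rw [div_pow, Real.sq_sqrt (rowSum_pos S i).le, mul_div_cancel₀ _ (rowSum_pos S i).ne', sq]

/-- If `S` is real symmetric positive definite, then `σ̃(S)` is symmetric positive definite,
and every eigenvalue `μ` of `σ̃(S)` satisfies `0 < μ ≤ 1`. -/
theorem softmaxTilde_posDef_and_eigenvalues
    (d : ℕ) (S : Matrix (Fin d) (Fin d) ℝ) (hS : S.PosDef) :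
    (softmaxTilde S).PosDef ∧
    (∀ (μ : ℝ) (v : Fin d → ℝ), v ≠ 0 → (softmaxTilde S).mulVec v = μ • v →
      0 < μ ∧ μ ≤ 1) := by
  refine ⟨softmaxTilde_posDef hS, fun μ v hv hμ => ?_⟩
  have hvv : 0 < v ⬝ᵥ v := by simpa using dotProduct_star_self_pos_iff.2 hv
  have hpos : 0 < v ⬝ᵥ (softmaxTilde S *ᵥ v) := by
    simpa using (softmaxTilde_posDef hS).dotProduct_mulVec_pos hv
  have hle := dotProduct_softmaxTilde_mulVec_le (isHermitian_iff_isSymm.1 hS.isHermitian) v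
  rw [hμ, dotProduct_smul, smul_eq_mul] at hpos hle
  exact ⟨pos_of_mul_pos_left hpos hvv.le, le_of_mul_le_mul_right (by simpa using hle) hvv⟩
end
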